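/- arXiv:2501.05672 — 3 statements merged into one kernel-verified Lean document; each statement's English description precedes it below -/
import Mathlib

section
/- Define g(a) = (1+η)𝔼[X − (X − (S+a)⁺)⁺] − a for a ∈ [0, π_f] and ā = inf{a ∈ [0, π_f] : g(a) ≤ 0}. If S ≥ 0 ℙ-almost surely and 𝔼[min(X, S)] > 0, then: (i) g is concave on [0, π_f]; (ii) ā is the unique solution of g(a) = 0 on [0, π_f]; and (iii) g(a) < 0 for every a ∈ (ā, π_f]. -/
open MeasureTheory Set

noncomputable section

variable {Ω : Type*} [MeasurableSpace Ω]
/-- Full-insurance premium `π_f = (1+η)𝔼[X]`. -/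
def piFull (ℙ : Measure Ω) (η : ℝ) (X : Ω → ℝ) : ℝ := (1 + η) * ∫ ω, X ω ∂ℙ

/-- `g(a) = (1+η)·𝔼[X − (X − (S+a)⁺)⁺] − a`. -/
def gfun (ℙ : Measure Ω) (η : ℝ) (X S : Ω → ℝ) (a : ℝ) : ℝ :=
  (1 + η) * ∫ ω, (X ω - max (X ω - max (S ω + a) 0) 0) ∂ℙ - a

/-- `ā = inf {a ∈ [0, π_f] : g(a) ≤ 0}`. -/
def abar (ℙ : Measure Ω) (η : ℝ) (X S : Ω → ℝ) : ℝ :=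
  sInf {a | a ∈ Icc 0 (piFull ℙ η X) ∧ gfun ℙ η X S a ≤ 0}

theorem sub_max_sub_zero_mem_Icc {x y : ℝ} (hx : 0 ≤ x) (hy : 0 ≤ y) :
    x - max (x - y) 0 ∈ Icc 0 x := by
  constructor
  · have : max (x - y) 0 ≤ x := max_le (by linarith) hx
    linarith
  · linarith [le_max_right (x - y) 0]

theorem concaveOn_sub_max_sub_add {x s : ℝ} :
    ConcaveOn ℝ univ (fun a : ℝ => x - max (x - (s + a)) 0) := by
  have h : ConvexOn ℝ univ (fun a : ℝ => x - (s + a)) := by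
    refine ⟨convex_univ, fun a _ b _ u v _ _ huv => ?_⟩
    obtain rfl : v = 1 - u := by linarith
    simp only [smul_eq_mul]
    exact le_of_eq (by ring)
  exact (concaveOn_const x convex_univ).sub (h.sup (convexOn_const 0 convex_univ))

/-- A real function with positive essential supremum is a.e. bounded above, since
`sInf ∅ = 0` in `ℝ`. -/
theorem exists_ae_le_of_essSup_pos {μ : Measure Ω} {f : Ω → ℝ} (h : 0 < essSup f μ) :
    ∃ c, ∀ᵐ ω ∂μ, f ω ≤ c := by
  by_contra hne
  have hempty : {c : ℝ | ∀ᵐ ω ∂μ, f ω ≤ c} = ∅ :=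
    eq_empty_of_forall_notMem fun c hc => hne ⟨c, hc⟩
  rw [essSup, Filter.limsup_eq, hempty, Real.sInf_empty] at h
  exact h.false

theorem integrable_of_nonneg_of_essSup_pos {μ : Measure Ω} [IsFiniteMeasure μ] {f : Ω → ℝ}
    (hf : AEStronglyMeasurable f μ) (hf0 : ∀ ω, 0 ≤ f ω) (h : 0 < essSup f μ) :
    Integrable f μ := by
  obtain ⟨c, hc⟩ := exists_ae_le_of_essSup_pos h
  refine Integrable.of_bound hf c ?_
  filter_upwards [hc] with ω hω
  rwa [Real.norm_of_nonneg (hf0 ω)]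

theorem neg_of_concaveOn_of_pos_of_eq_zero {g : ℝ → ℝ} {p c a : ℝ}
    (hg : ConcaveOn ℝ (Icc 0 p) g) (h0 : 0 < g 0) (hc : 0 ≤ c) (hgc : g c = 0)
    (ha : a ∈ Ioc c p) : g a < 0 := by
  have hc0 : 0 < c := hc.lt_of_ne fun h => by simp [h, hgc] at h0
  have hslope := hg.slope_anti_adjacent ⟨le_rfl, by linarith [ha.1, ha.2]⟩
    ⟨by linarith [ha.1], ha.2⟩ hc0 ha.1
  rw [hgc, zero_sub, sub_zero, sub_zero] at hslope
  have hneg : g a / (a - c) < 0 := hslope.trans_lt (div_neg_of_neg_of_pos (by linarith) hc0)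
  have hac : 0 < a - c := sub_pos.2 ha.1
  by_contra! hga
  exact hneg.not_ge (div_nonneg hga hac.le)

/-- The first point of `[0, p]` where a continuous function starting positive and ending
nonpositive is `≤ 0` is a zero of it. -/
theorem sInf_nonpos_mem_Icc_and_eq_zero {g : ℝ → ℝ} {p : ℝ} (hg : Continuous g) (hp : 0 ≤ p)
    (h0 : 0 < g 0) (hgp : g p ≤ 0) :
    sInf {a | a ∈ Icc 0 p ∧ g a ≤ 0} ∈ Icc 0 p ∧ g (sInf {a | a ∈ Icc 0 p ∧ g a ≤ 0}) = 0 := by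
  set A := {a | a ∈ Icc 0 p ∧ g a ≤ 0}
  have hbdd : BddBelow A := ⟨0, fun a ha => ha.1.1⟩
  have hclosed : IsClosed A := isClosed_Icc.inter (isClosed_le hg continuous_const)
  have hmem : sInf A ∈ A := hclosed.csInf_mem ⟨p, ⟨hp, le_rfl⟩, hgp⟩ hbdd
  refine ⟨hmem.1, ?_⟩
  obtain ⟨c, hc, hgc⟩ := intermediate_value_Icc' hmem.1.1 hg.continuousOn ⟨hmem.2, h0.le⟩
  have hle : sInf A ≤ c := csInf_le hbdd ⟨⟨hc.1, hc.2.trans hmem.1.2⟩, hgc.le⟩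
  rwa [hle.antisymm hc.2]

section gfun

variable {ℙ : Measure Ω} {η : ℝ} {X S : Ω → ℝ}

theorem integrable_sub_max_sub_max (hX : Integrable X ℙ) (hXm : Measurable X)
    (hSm : Measurable S) (hX0 : ∀ ω, 0 ≤ X ω) (a : ℝ) :
    Integrable (fun ω => X ω - max (X ω - max (S ω + a) 0) 0) ℙ := by
  refine hX.mono' (by fun_prop) (.of_forall fun ω => ?_)
  have h := sub_max_sub_zero_mem_Icc (hX0 ω) (le_max_right (S ω + a) 0)
  rw [Real.norm_of_nonneg h.1]
  exact h.2

theorem continuous_gfun (hX : Integrable X ℙ) (hXm : Measurable X)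
    (hSm : Measurable S) (hX0 : ∀ ω, 0 ≤ X ω) : Continuous (gfun ℙ η X S) := by
  refine (continuous_const.mul ?_).sub continuous_id
  refine continuous_of_dominated (bound := X) (fun a => by fun_prop)
    (fun a => .of_forall fun ω => ?_) hX (.of_forall fun ω => by fun_prop)
  have h := sub_max_sub_zero_mem_Icc (hX0 ω) (le_max_right (S ω + a) 0)
  rw [Real.norm_of_nonneg h.1]
  exact h.2

theorem concaveOn_gfun (hX : Integrable X ℙ) (hXm : Measurable X)
    (hSm : Measurable S) (hX0 : ∀ ω, 0 ≤ X ω) (hη : 0 ≤ η) (hS0 : ∀ᵐ ω ∂ℙ, 0 ≤ S ω) :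
    ConcaveOn ℝ (Ici 0) (gfun ℙ η X S) := by
  have hint := integrable_sub_max_sub_max hX hXm hSm hX0
  have hconc : ConcaveOn ℝ (Ici 0)
      (fun a => ∫ ω, (X ω - max (X ω - max (S ω + a) 0) 0) ∂ℙ) := by
    refine ⟨convex_Ici 0, fun a ha b hb u v hu hv huv => ?_⟩
    have hab : 0 ≤ u • a + v • b := convex_Ici 0 ha hb hu hv huv
    simp only [smul_eq_mul] at hab ⊢
    rw [← integral_const_mul, ← integral_const_mul,
      ← integral_add ((hint a).const_mul u) ((hint b).const_mul v)]
    refine integral_mono_ae (((hint a).const_mul u).add ((hint b).const_mul v)) (hint _) ?_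
    filter_upwards [hS0] with ω hω
    have h := (concaveOn_sub_max_sub_add (x := X ω) (s := S ω)).2
      (mem_univ a) (mem_univ b) hu hv huv
    simpa only [smul_eq_mul, max_eq_left (add_nonneg hω ha), max_eq_left (add_nonneg hω hb),
      max_eq_left (add_nonneg hω hab)] using h
  exact (hconc.smul (by linarith : 0 ≤ 1 + η)).sub (convexOn_id (convex_Ici 0))

theorem gfun_zero (hS0 : ∀ᵐ ω ∂ℙ, 0 ≤ S ω) :
    gfun ℙ η X S 0 = (1 + η) * ∫ ω, min (X ω) (S ω) ∂ℙ := by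
  rw [gfun, sub_zero]
  congr 1
  refine integral_congr_ae ?_
  filter_upwards [hS0] with ω hω
  rw [add_zero, max_eq_left hω]
  rcases le_total (X ω) (S ω) with h | h
  · rw [max_eq_right (by linarith), min_eq_left h, sub_zero]
  · rw [max_eq_left (by linarith), min_eq_right h, sub_sub_cancel]

theorem gfun_piFull_nonpos (hX : Integrable X ℙ) (hXm : Measurable X)
    (hSm : Measurable S) (hX0 : ∀ ω, 0 ≤ X ω) (hη : 0 ≤ η) :
    gfun ℙ η X S (piFull ℙ η X) ≤ 0 := by
  refine sub_nonpos.2 (mul_le_mul_of_nonneg_left ?_ (by linarith))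
  exact integral_mono (integrable_sub_max_sub_max hX hXm hSm hX0 _) hX fun ω =>
    (sub_max_sub_zero_mem_Icc (hX0 ω) (le_max_right _ 0)).2

end gfun

/-- if `S ≥ 0` a.s. and `𝔼[min(X,S)] > 0`, then `g` is concave on `[0, π_f]`,
`ā` is the unique zero of `g` on `[0, π_f]`, and `g(a) < 0` for every `a ∈ (ā, π_f]`. -/
theorem stmt3
    (ℙ : Measure Ω) [IsProbabilityMeasure ℙ]
    (X S : Ω → ℝ) (hXm : Measurable X) (hSm : Measurable S)
    (hX0 : ∀ ω, 0 ≤ X ω) (M : ℝ) (hM : essSup X ℙ = M) (hM0 : 0 < M)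
    (η : ℝ) (hη : 0 ≤ η)
    (hS0 : ∀ᵐ ω ∂ℙ, 0 ≤ S ω)
    (hXS : 0 < ∫ ω, min (X ω) (S ω) ∂ℙ) :
    ConcaveOn ℝ (Icc 0 (piFull ℙ η X)) (gfun ℙ η X S) ∧
    gfun ℙ η X S (abar ℙ η X S) = 0 ∧
    (∀ a ∈ Icc 0 (piFull ℙ η X), gfun ℙ η X S a = 0 → a = abar ℙ η X S) ∧
    ∀ a ∈ Ioc (abar ℙ η X S) (piFull ℙ η X), gfun ℙ η X S a < 0 := by
  have hX : Integrable X ℙ :=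
    integrable_of_nonneg_of_essSup_pos hXm.aestronglyMeasurable hX0 (hM ▸ hM0)
  have hη1 : 0 < 1 + η := by linarith
  have hp : 0 ≤ piFull ℙ η X := mul_nonneg hη1.le (integral_nonneg hX0)
  have hconc : ConcaveOn ℝ (Icc 0 (piFull ℙ η X)) (gfun ℙ η X S) :=
    (concaveOn_gfun hX hXm hSm hX0 hη hS0).subset Icc_subset_Ici_self (convex_Icc _ _)
  have h0 : 0 < gfun ℙ η X S 0 := by
    rw [gfun_zero hS0]
    exact mul_pos hη1 hXS
  obtain ⟨hmem, hzero⟩ : abar ℙ η X S ∈ Icc 0 (piFull ℙ η X) ∧ gfun ℙ η X S (abar ℙ η X S) = 0 :=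
    sInf_nonpos_mem_Icc_and_eq_zero (continuous_gfun hX hXm hSm hX0) hp h0
      (gfun_piFull_nonpos hX hXm hSm hX0 hη)
  have hneg : ∀ a ∈ Ioc (abar ℙ η X S) (piFull ℙ η X), gfun ℙ η X S a < 0 := fun a ha =>
    neg_of_concaveOn_of_pos_of_eq_zero hconc h0 hmem.1 hzero ha
  refine ⟨hconc, hzero, fun a ha hga => ?_, hneg⟩
  have hle : abar ℙ η X S ≤ a := csInf_le ⟨0, fun b hb => hb.1.1⟩ ⟨ha, hga.le⟩
  exact (hle.eq_or_lt.resolve_right fun hlt => (hneg a ⟨hlt, ha.2⟩).ne hga).symm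
end
end

section
/- Fix a ∈ [0, ā] and let d ∈ [0, M] satisfy g_a(d) = 0, where g_a(y) = (1+η)𝔼[(X − y)⁺ − (X − y − (S+a)⁺)⁺] − a. Define I*_a(x, s) = (x − d)⁺ − (x − d − (s + a)⁺)⁺. Then I*_a ∈ 𝓐 with π(I*_a) = a, the seller never defaults under I*_a (i.e., I*_a(X,S) ≤ (S + a)⁺ a.s., so 𝕀(I*_a) = I*_a(X,S)), and 𝔼[u(W(I*_a))] ≥ 𝔼[u(W(I))] for every I ∈ 𝓐 with π(I) = a. -/
open MeasureTheory Set

noncomputable section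

variable {Ω : Type*} [MeasurableSpace Ω]

/-- Expected-value premium of an indemnity `I = I(x, s)`. -/
def premium (ℙ : Measure Ω) (η : ℝ) (X S : Ω → ℝ) (I : ℝ → ℝ → ℝ) : ℝ :=
  (1 + η) * ∫ ω, I (X ω) (S ω) ∂ℙ

/-- Buyer's terminal wealth under endogenous default with recovery ratio `τ`:
`W(I) = w − X − π(I) + 𝕀(I)` where `𝕀(I) = I·1_{I ≤ R} + τ·R·1_{I > R}` and
`R = (S + π(I))⁺`. -/
def wealth (ℙ : Measure Ω) (η τ w : ℝ) (X S : Ω → ℝ) (I : ℝ → ℝ → ℝ) (ω : Ω) : ℝ :=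
  w - X ω - premium ℙ η X S I +
    (if I (X ω) (S ω) ≤ max (S ω + premium ℙ η X S I) 0 then I (X ω) (S ω)
     else τ * max (S ω + premium ℙ η X S I) 0)

/-- Buyer's expected utility `𝔼[u(W(I))]`. -/
def EU (ℙ : Measure Ω) (η τ w : ℝ) (X S : Ω → ℝ) (u : ℝ → ℝ) (I : ℝ → ℝ → ℝ) : ℝ :=
  ∫ ω, u (wealth ℙ η τ w X S I ω) ∂ℙ

/-- Admissible indemnities `𝓐`: measurable and `0 ≤ I(x,s) ≤ x` on `[0, M] × ℝ`. -/
def Adm (M : ℝ) (I : ℝ → ℝ → ℝ) : Prop :=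
  Measurable (fun p : ℝ × ℝ => I p.1 p.2) ∧
    ∀ x ∈ Icc (0 : ℝ) M, ∀ s : ℝ, 0 ≤ I x s ∧ I x s ≤ x

/-- `g_a(y) = (1+η)·𝔼[(X − y)⁺ − (X − y − (S+a)⁺)⁺] − a`. -/
def gposA (ℙ : Measure Ω) (η : ℝ) (X S : Ω → ℝ) (a y : ℝ) : ℝ :=
  (1 + η) * ∫ ω, (max (X ω - y) 0 - max (X ω - y - max (S ω + a) 0) 0) ∂ℙ - a

/-- The deductible contract `I*_a(x,s) = (x − d)⁺ − (x − d − (s + a)⁺)⁺`. -/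
def dedPos (d a : ℝ) : ℝ → ℝ → ℝ :=
  fun x s => max (x - d) 0 - max (x - d - max (s + a) 0) 0

/-- A function with antitone derivative lies below its tangent lines. -/
lemma le_tangent_of_antitone_deriv {u u' : ℝ → ℝ} (hu' : ∀ x, HasDerivAt u (u' x) x)
    (hanti : Antitone u') (y z : ℝ) : u y ≤ u z + u' z * (y - z) := by
  have hc : Continuous u := continuous_iff_continuousAt.2 fun x => (hu' x).continuousAt
  rcases lt_trichotomy y z with h | rfl | h
  · obtain ⟨t, ht, hs⟩ := exists_hasDerivAt_eq_slope u u' h hc.continuousOn fun x _ => hu' x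
    have h1 := hanti ht.2.le
    rw [eq_div_iff (by linarith)] at hs
    nlinarith
  · simp
  · obtain ⟨t, ht, hs⟩ := exists_hasDerivAt_eq_slope u u' h hc.continuousOn fun x _ => hu' x
    have h1 := hanti ht.1.le
    rw [eq_div_iff (by linarith)] at hs
    nlinarith

/-- The deductible contract with a limit is the minimum of the excess loss and the reserve. -/
lemma dedPos_eq_min (d a x s : ℝ) :
    dedPos d a x s = min (max (x - d) 0) (max (s + a) 0) := by
  have hR : 0 ≤ max (s + a) 0 := le_max_right _ _
  unfold dedPos
  generalize max (s + a) 0 = R at hR ⊢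
  grind

lemma dedPos_nonneg (d a x s : ℝ) : 0 ≤ dedPos d a x s := by
  rw [dedPos_eq_min]
  exact le_min (le_max_right _ _) (le_max_right _ _)

lemma dedPos_le_reserve (d a x s : ℝ) : dedPos d a x s ≤ max (s + a) 0 := by
  rw [dedPos_eq_min]
  exact min_le_right _ _

lemma dedPos_le_loss {d x : ℝ} (hd : 0 ≤ d) (hx : 0 ≤ x) (a s : ℝ) : dedPos d a x s ≤ x := by
  rw [dedPos_eq_min]
  exact (min_le_left _ _).trans (max_le (by linarith) hx)

lemma measurable_dedPos (d a : ℝ) : Measurable (fun p : ℝ × ℝ => dedPos d a p.1 p.2) := by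
  unfold dedPos
  fun_prop

lemma dedPos_adm {d : ℝ} (hd : 0 ≤ d) (M a : ℝ) : Adm M (dedPos d a) :=
  ⟨measurable_dedPos d a, fun x hx s => ⟨dedPos_nonneg d a x s, dedPos_le_loss hd hx.1 a s⟩⟩

/-- Pointwise comparison of the deductible contract with a payment `j` between zero and the
reserve: utility minus `u' (w - a - d)` times the payment is maximal at `dedPos`. -/
lemma utility_le_lagrangian {u u' : ℝ → ℝ} (hu' : ∀ x, HasDerivAt u (u' x) x)
    (hanti : Antitone u') (w d a x s j : ℝ) (hj0 : 0 ≤ j) (hjR : j ≤ max (s + a) 0) :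
    u (w - x - a + j) ≤
      u (w - x - a + dedPos d a x s) - u' (w - a - d) * (dedPos d a x s - j) := by
  have htan := le_tangent_of_antitone_deriv hu' hanti (w - x - a + j)
    (w - x - a + dedPos d a x s)
  suffices h : 0 ≤ (u' (w - x - a + dedPos d a x s) - u' (w - a - d)) * (dedPos d a x s - j) by
    nlinarith
  rw [dedPos_eq_min]
  rcases le_total x d with hxd | hxd
  · rw [max_eq_right (by linarith : x - d ≤ 0), min_eq_left (le_max_right _ _)]
    exact mul_nonneg_of_nonpos_of_nonpos (sub_nonpos.2 (hanti (by linarith))) (by linarith)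
  · rw [max_eq_left (by linarith : 0 ≤ x - d)]
    rcases le_total (x - d) (max (s + a) 0) with hR | hR
    · rw [min_eq_left hR, show w - x - a + (x - d) = w - a - d by ring]
      simp
    · rw [min_eq_right hR]
      exact mul_nonneg (sub_nonneg.2 (hanti (by linarith))) (by linarith)

/-- A loss with positive real essential supremum is almost surely bounded by it. -/
lemma ae_le_of_essSup_pos {ℙ : Measure Ω} {X : Ω → ℝ} (hpos : 0 < essSup X ℙ) :
    ∀ᵐ ω ∂ℙ, X ω ≤ essSup X ℙ := by
  refine ae_le_essSup ?_
  by_contra hb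
  have hempty : {b : ℝ | ∀ᶠ ω in ae ℙ, X ω ≤ b} = ∅ := by
    refine Set.eq_empty_of_forall_notMem fun b h => hb ⟨b, ?_⟩
    simpa using h
  rw [essSup, Filter.limsup_eq, hempty, Real.sInf_empty] at hpos
  exact lt_irrefl _ hpos

lemma integrable_comp_of_ae_mem_Icc {ℙ : Measure Ω} [IsFiniteMeasure ℙ] {u : ℝ → ℝ}
    (hu : Continuous u) {f : Ω → ℝ} (hf : Measurable f) {A B : ℝ}
    (hAB : ∀ᵐ ω ∂ℙ, f ω ∈ Icc A B) : Integrable (fun ω => u (f ω)) ℙ := by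
  obtain ⟨C, hC⟩ := (isCompact_Icc (a := A) (b := B)).exists_bound_of_continuousOn hu.continuousOn
  exact Integrable.of_bound (hu.measurable.comp hf).aestronglyMeasurable C
    (hAB.mono fun ω h => hC _ h)

section Contracts

variable {ℙ : Measure Ω} [IsProbabilityMeasure ℙ] {X S : Ω → ℝ} {M : ℝ} {I : ℝ → ℝ → ℝ}

lemma Adm.integrable (hI : Adm M I) (hXm : Measurable X) (hSm : Measurable S)
    (hX : ∀ᵐ ω ∂ℙ, X ω ∈ Icc 0 M) : Integrable (fun ω => I (X ω) (S ω)) ℙ := by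
  refine integrable_comp_of_ae_mem_Icc continuous_id (A := 0) (B := M)
    (hI.1.comp (hXm.prodMk hSm)) ?_
  filter_upwards [hX] with ω hω
  exact ⟨(hI.2 _ hω _).1, (hI.2 _ hω _).2.trans hω.2⟩

lemma Adm.integrable_utility_wealth (hI : Adm M I) (hXm : Measurable X) (hSm : Measurable S)
    (hX : ∀ᵐ ω ∂ℙ, X ω ∈ Icc 0 M) {u : ℝ → ℝ} (hu : Continuous u) (η w : ℝ) {τ : ℝ}
    (hτ : τ ∈ Icc (0 : ℝ) 1) : Integrable (fun ω => u (wealth ℙ η τ w X S I ω)) ℙ := by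
  have hIm : Measurable fun ω => I (X ω) (S ω) := hI.1.comp (hXm.prodMk hSm)
  refine integrable_comp_of_ae_mem_Icc hu (A := w - M - premium ℙ η X S I)
    (B := w - premium ℙ η X S I + M) ?_ ?_
  · unfold wealth
    refine Measurable.add (by fun_prop) (Measurable.ite ?_ hIm (by fun_prop))
    exact measurableSet_le hIm (by fun_prop)
  · filter_upwards [hX] with ω hω
    obtain ⟨h0, h1⟩ := hI.2 _ hω (S ω)
    obtain ⟨hx0, hxM⟩ := hω
    have hR : 0 ≤ max (S ω + premium ℙ η X S I) 0 := le_max_right _ _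
    unfold wealth
    split_ifs with h
    · constructor <;> linarith
    · have := mul_nonneg hτ.1 hR
      have := mul_le_of_le_one_left hR hτ.2
      constructor <;> linarith

end Contracts

/-- for `a ∈ [0, ā]` and `d ∈ [0, M]` with `g_a(d) = 0`, the contract
`I*_a` is admissible with premium `a`, is default-free, and is optimal among all
admissible contracts with premium `a`. -/
theorem stmt7
    (ℙ : Measure Ω) [IsProbabilityMeasure ℙ]
    (X S : Ω → ℝ) (hXm : Measurable X) (hSm : Measurable S)
    (hX0 : ∀ ω, 0 ≤ X ω) (M : ℝ) (hM : essSup X ℙ = M) (hM0 : 0 < M)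
    (η : ℝ) (hη : 0 ≤ η) (τ : ℝ) (hτ : τ ∈ Icc (0 : ℝ) 1) (w : ℝ)
    (u u' u'' : ℝ → ℝ)
    (hu' : ∀ x, HasDerivAt u (u' x) x) (hu'' : ∀ x, HasDerivAt u' (u'' x) x)
    (hu'pos : ∀ x, 0 < u' x) (hu''neg : ∀ x, u'' x < 0)
    (a : ℝ) (ha : a ∈ Icc 0 (abar ℙ η X S))
    (d : ℝ) (hdmem : d ∈ Icc (0 : ℝ) M) (hd : gposA ℙ η X S a d = 0) :
    Adm M (dedPos d a) ∧
    premium ℙ η X S (dedPos d a) = a ∧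
    (∀ᵐ ω ∂ℙ, dedPos d a (X ω) (S ω) ≤ max (S ω + a) 0) ∧
    ∀ I : ℝ → ℝ → ℝ, Adm M I → premium ℙ η X S I = a →
      EU ℙ η τ w X S u I ≤ EU ℙ η τ w X S u (dedPos d a) := by
  subst hM
  have hX : ∀ᵐ ω ∂ℙ, X ω ∈ Icc 0 (essSup X ℙ) :=
    (ae_le_of_essSup_pos hM0).mono fun ω h => ⟨hX0 ω, h⟩
  have hanti : Antitone u' :=
    antitone_of_deriv_nonpos (fun x => (hu'' x).differentiableAt) fun x => by
      rw [(hu'' x).deriv]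
      exact (hu''neg x).le
  have hcont : Continuous u := continuous_iff_continuousAt.2 fun x => (hu' x).continuousAt
  have hadm : Adm (essSup X ℙ) (dedPos d a) := dedPos_adm hdmem.1 _ a
  have hprem : premium ℙ η X S (dedPos d a) = a := sub_eq_zero.1 hd
  refine ⟨hadm, hprem, ae_of_all _ fun ω => dedPos_le_reserve d a _ _, fun I hI hIa => ?_⟩
  have hint : Integrable (fun ω => dedPos d a (X ω) (S ω)) ℙ := hadm.integrable hXm hSm hX
  have hintI : Integrable (fun ω => I (X ω) (S ω)) ℙ := hI.integrable hXm hSm hX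
  have hU := hadm.integrable_utility_wealth hXm hSm hX hcont η w hτ
  have hmean : ∫ ω, dedPos d a (X ω) (S ω) ∂ℙ = ∫ ω, I (X ω) (S ω) ∂ℙ :=
    mul_left_cancel₀ (by positivity : 1 + η ≠ 0) (hprem.trans hIa.symm)
  set k := u' (w - a - d)
  have hL : Integrable (fun ω => k * (dedPos d a (X ω) (S ω) - I (X ω) (S ω))) ℙ :=
    (hint.sub hintI).const_mul k
  calc EU ℙ η τ w X S u I
      ≤ ∫ ω, (u (wealth ℙ η τ w X S (dedPos d a) ω) -
          k * (dedPos d a (X ω) (S ω) - I (X ω) (S ω))) ∂ℙ := by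
        refine integral_mono_ae (hI.integrable_utility_wealth hXm hSm hX hcont η w hτ)
          (hU.sub hL) ?_
        filter_upwards [hX] with ω hω
        have hR : 0 ≤ max (S ω + a) 0 := le_max_right _ _
        simp only [wealth, hprem, hIa, if_pos (dedPos_le_reserve d a _ _)]
        split_ifs with h
        · exact utility_le_lagrangian hu' hanti w d a _ _ _ (hI.2 _ hω _).1 h
        · have hle := utility_le_lagrangian hu' hanti w d a (X ω) (S ω) _
            (mul_nonneg hτ.1 hR) (mul_le_of_le_one_left hR hτ.2)
          have hτR := mul_le_of_le_one_left hR hτ.2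
          have hkI := mul_le_mul_of_nonneg_left (hτR.trans (not_le.1 h).le)
            (hu'pos (w - a - d)).le
          linarith
    _ = EU ℙ η τ w X S u (dedPos d a) := by
        rw [integral_sub hU hL, integral_const_mul, integral_sub hint hintI, hmean]
        simp [EU]
end
end

section
/- Suppose Assumption A holds and 0 < η < u′(w − M)/𝔼[u′(w − X)] − 1. Then the equation 𝔼[u′(w − min(X, d(a)) − a)] = u′(w − d(a) − a)/(1+η) has a unique solution a* ∈ (0, ā), where d(a) is the unique zero of g_a(y) = (1+η)𝔼[(X − y)⁺ − (X − y − (S+a))⁺] − a in [0, M]; and the contract I*(x, s) = (x − d(a*))⁺ − (x − d(a*) − s − a*)⁺ is globally optimal: 𝔼[u(W(I*))] ≥ 𝔼[u(W(I))] for every I ∈ 𝓐. -/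
open MeasureTheory Set

noncomputable section

variable {Ω : Type*} [MeasurableSpace Ω]

/-- Distribution function of a random variable. -/
def distFn (ℙ : Measure Ω) (Y : Ω → ℝ) (t : ℝ) : ℝ := (ℙ {ω | Y ω ≤ t}).toReal

/-- The set of discontinuity points in `[0, M]` of the distribution function of `Y`. -/
def JumpSet (ℙ : Measure Ω) (Y : Ω → ℝ) (M : ℝ) : Set ℝ :=
  {x ∈ Icc (0 : ℝ) M | ¬ ContinuousAt (distFn ℙ Y) x}

/-- Assumption A: (1) `S ≥ 0` a.s.; (2) the distribution functions of `X` and of `X − S`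
have finitely many discontinuity points in `[0, M]`; (3) the distribution function of `X`
is strictly increasing on `[0, M]`; (4) `𝔼[(X − y)⁺ − (X − y − S)⁺] > 0` for `y ∈ [0, M)`. -/
def AssumpA (ℙ : Measure Ω) (X S : Ω → ℝ) (M : ℝ) : Prop :=
  (∀ᵐ ω ∂ℙ, 0 ≤ S ω) ∧
  (JumpSet ℙ X M).Finite ∧
  (JumpSet ℙ (fun ω => X ω - S ω) M).Finite ∧
  StrictMonoOn (distFn ℙ X) (Icc 0 M) ∧
  ∀ y ∈ Ico (0 : ℝ) M, 0 < ∫ ω, (max (X ω - y) 0 - max (X ω - y - S ω) 0) ∂ℙ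

/-- `g_a(y) = (1+η)·𝔼[(X − y)⁺ − (X − y − (S+a))⁺] − a`. -/
def gA (ℙ : Measure Ω) (η : ℝ) (X S : Ω → ℝ) (a y : ℝ) : ℝ :=
  (1 + η) * ∫ ω, (max (X ω - y) 0 - max (X ω - y - (S ω + a)) 0) ∂ℙ - a

/-- The threshold `u′(w − M)/𝔼[u′(w − X)] − 1` for the premium loading. -/
def thr (ℙ : Measure Ω) (X : Ω → ℝ) (u' : ℝ → ℝ) (w M : ℝ) : ℝ :=
  u' (w - M) / (∫ ω, u' (w - X ω) ∂ℙ) - 1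

/-- The deductible contract `(x − d)⁺ − (x − d − s − a)⁺`. -/
def ded (d a : ℝ) : ℝ → ℝ → ℝ :=
  fun x s => max (x - d) 0 - max (x - d - s - a) 0

lemma ae_le_of_essSup_eq {ℙ : Measure Ω} {X : Ω → ℝ} {M : ℝ} (hM : essSup X ℙ = M)
    (hM0 : 0 < M) : ∀ᵐ ω ∂ℙ, X ω ≤ M := by
  by_cases hb : Filter.IsBoundedUnder (· ≤ ·) (ae ℙ) X
  · exact hM ▸ ae_le_essSup hb
  · exfalso
    have hempty : {a | ∀ᶠ n in ae ℙ, X n ≤ a} = ∅ := by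
      ext a
      simp only [mem_ofPred_eq, mem_empty_iff_false, iff_false]
      exact fun ha => hb ⟨a, Filter.eventually_map.2 ha⟩
    rw [essSup, Filter.limsup_eq, hempty, Real.sInf_empty] at hM
    exact hM0.ne hM

lemma integrable_comp_of_ae_mem_compact {E : Type*} [TopologicalSpace E] [MeasurableSpace E]
    [OpensMeasurableSpace E] {ℙ : Measure Ω} [IsFiniteMeasure ℙ] {φ : E → ℝ}
    (hφ : Continuous φ) {f : Ω → E} (hf : Measurable f) {K : Set E} (hK : IsCompact K)
    (hfK : ∀ᵐ ω ∂ℙ, f ω ∈ K) : Integrable (fun ω => φ (f ω)) ℙ := by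
  obtain ⟨C, hC⟩ := hK.exists_bound_of_continuousOn hφ.continuousOn
  exact Integrable.of_bound (hφ.measurable.comp hf).aestronglyMeasurable C
    (hfK.mono fun ω hω => hC _ hω)

lemma le_tangent {u u' : ℝ → ℝ} (hu : ∀ x, HasDerivAt u (u' x) x) (hu' : StrictAnti u')
    (x y : ℝ) : u x ≤ u y + u' y * (x - y) := by
  have hcont : Continuous u := continuous_iff_continuousAt.2 fun z => (hu z).continuousAt
  rcases lt_trichotomy x y with h | h | h
  · obtain ⟨c, hc, he⟩ := exists_hasDerivAt_eq_slope u u' h hcont.continuousOn fun z _ => hu z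
    have h1 := hu' hc.2
    rw [eq_div_iff (by linarith)] at he
    nlinarith
  · simp [h]
  · obtain ⟨c, hc, he⟩ := exists_hasDerivAt_eq_slope u u' h hcont.continuousOn fun z _ => hu z
    have h1 := hu' hc.1
    rw [eq_div_iff (by linarith)] at he
    nlinarith

/-- A function implicitly defined by a continuous equation with a unique zero in a compact set is
continuous. -/
lemma continuousOn_of_unique_zero {f : ℝ × ℝ → ℝ} {s K : Set ℝ} (hK : IsCompact K)
    (hf : ContinuousOn f (s ×ˢ K)) {d : ℝ → ℝ} (hdK : ∀ a ∈ s, d a ∈ K)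
    (hd : ∀ a ∈ s, f (a, d a) = 0) (huniq : ∀ a ∈ s, ∀ y ∈ K, f (a, y) = 0 → y = d a) :
    ContinuousOn d s := by
  intro a ha
  have hmem : ∀ᶠ b in nhdsWithin a s, b ∈ s := self_mem_nhdsWithin
  refine hK.tendsto_nhds_of_unique_mapClusterPt (hmem.mono hdK) fun y hy hcl => ?_
  refine huniq a ha y hy ?_
  obtain ⟨U, hU, hUy⟩ := mapClusterPt_iff_ultrafilter.1 hcl
  have hUs : ∀ᶠ b in (U : Filter ℝ), b ∈ s := hU hmem
  have hpair : Filter.Tendsto (fun b => (b, d b)) U (nhdsWithin (a, y) (s ×ˢ K)) := by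
    refine tendsto_nhdsWithin_iff.2 ⟨?_, hUs.mono fun b hb => ⟨hb, hdK b hb⟩⟩
    exact (Filter.tendsto_id'.2 (hU.trans nhdsWithin_le_nhds)).prodMk_nhds hUy
  have hlim := (hf (a, y) ⟨ha, hy⟩).tendsto.comp hpair
  refine tendsto_nhds_unique hlim (tendsto_const_nhds.congr' ?_)
  exact hUs.mono fun b hb => (hd b hb).symm

lemma ded_eq_min {d a x s : ℝ} (h : 0 ≤ s + a) : ded d a x s = min (max (x - d) 0) (s + a) := by
  unfold ded
  grind

lemma ded_nonneg {d a x s : ℝ} (h : 0 ≤ s + a) : 0 ≤ ded d a x s := by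
  rw [ded_eq_min h]
  exact le_min (le_max_right _ _) h

lemma ded_le_reserve {d a x s : ℝ} (h : 0 ≤ s + a) : ded d a x s ≤ s + a := by
  rw [ded_eq_min h]
  exact min_le_right _ _

lemma ded_le_loss {d a x s : ℝ} (h : 0 ≤ s + a) (hd : 0 ≤ d) (hx : 0 ≤ x) :
    ded d a x s ≤ x := by
  rw [ded_eq_min h]
  exact (min_le_left _ _).trans (max_le (by linarith) hx)

lemma measurable_ded {X S : Ω → ℝ} (hX : Measurable X) (hS : Measurable S) (d a : ℝ) :
    Measurable fun ω => ded d a (X ω) (S ω) := by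
  unfold ded
  fun_prop

lemma gA_eq (ℙ : Measure Ω) (η : ℝ) (X S : Ω → ℝ) (a y : ℝ) :
    gA ℙ η X S a y = (1 + η) * ∫ ω, ded y a (X ω) (S ω) ∂ℙ - a := by
  simp only [gA, ded, sub_sub, add_assoc]

/-- The first-order gain of moving from the deductible contract to any payoff `y` funded by the
premium `a` is at most its Lagrangian bound. -/
lemma marginal_le {u' : ℝ → ℝ} (hu' : Antitone u') {w d b a x s y : ℝ}
    (hsb : 0 ≤ s + b) (hy0 : 0 ≤ y) (hys : y ≤ s + a) :
    u' (w - x - b + ded d b x s) * ((w - x - a + y) - (w - x - b + ded d b x s)) ≤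
      u' (w - d - b) * (y - ded d b x s) - u' (w - min x d - b) * (a - b) := by
  rw [ded_eq_min hsb]
  rcases le_total x d with hxd | hxd
  · rw [max_eq_right (by linarith), min_eq_left hsb, min_eq_left hxd, add_zero]
    have h := hu' (show w - d - b ≤ w - x - b by linarith)
    nlinarith [mul_le_mul_of_nonneg_right h hy0]
  · rw [max_eq_left (by linarith), min_eq_right hxd]
    rcases le_total (x - d) (s + b) with hc | hc
    · rw [min_eq_left hc]
      have : w - x - b + (x - d) = w - d - b := by ring
      rw [this]
      apply le_of_eq
      ring
    · rw [min_eq_right hc]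
      have h := hu' (show w - x - b + (s + b) ≤ w - d - b by linarith)
      nlinarith [mul_le_mul_of_nonneg_right h (show 0 ≤ s + a - y by linarith)]

/-- Variational inequality characterising a deductible contract that satisfies the first-order
equation. -/
lemma integral_marginal_nonpos {ℙ : Measure Ω} [IsProbabilityMeasure ℙ] {X S Y : Ω → ℝ}
    (hX : Measurable X) (hS : Measurable S) (hY : Measurable Y) {M η w a b d : ℝ}
    (hXM : ∀ᵐ ω ∂ℙ, X ω ∈ Icc 0 M) (hS0 : ∀ᵐ ω ∂ℙ, 0 ≤ S ω) {u' : ℝ → ℝ}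
    (hu' : Antitone u') (hu'c : Continuous u') (hu'pos : ∀ x, 0 < u' x) (hη : 0 < η)
    (hd : 0 ≤ d) (hb : 0 ≤ b) (hprem : (1 + η) * ∫ ω, ded d b (X ω) (S ω) ∂ℙ = b)
    (hfoc : ∫ ω, u' (w - min (X ω) d - b) ∂ℙ = u' (w - d - b) / (1 + η))
    (hYX : ∀ᵐ ω ∂ℙ, Y ω ∈ Icc 0 (X ω)) (hYS : ∀ᵐ ω ∂ℙ, Y ω ≤ S ω + a)
    (hYprem : (1 + η) * ∫ ω, Y ω ∂ℙ ≤ a) :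
    Integrable (fun ω => u' (w - X ω - b + ded d b (X ω) (S ω)) *
      ((w - X ω - a + Y ω) - (w - X ω - b + ded d b (X ω) (S ω)))) ℙ ∧
    ∫ ω, u' (w - X ω - b + ded d b (X ω) (S ω)) *
      ((w - X ω - a + Y ω) - (w - X ω - b + ded d b (X ω) (S ω))) ∂ℙ ≤ 0 := by
  have hD := measurable_ded hX hS d b
  have hDX : ∀ᵐ ω ∂ℙ, ded d b (X ω) (S ω) ∈ Icc 0 (X ω) := by
    filter_upwards [hXM, hS0] with ω h1 h2
    exact ⟨ded_nonneg (by linarith), ded_le_loss (by linarith) hd h1.1⟩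
  have hint : Integrable (fun ω => u' (w - X ω - b + ded d b (X ω) (S ω)) *
      ((w - X ω - a + Y ω) - (w - X ω - b + ded d b (X ω) (S ω)))) ℙ := by
    refine integrable_comp_of_ae_mem_compact (E := ℝ × ℝ)
      (φ := fun p => u' p.1 * (p.2 - p.1))
      (f := fun ω => (w - X ω - b + ded d b (X ω) (S ω), w - X ω - a + Y ω))
      (K := Icc (w - M - b) (w - b) ×ˢ Icc (w - M - a) (w - a)) (by fun_prop) (by fun_prop)
      (isCompact_Icc.prod isCompact_Icc) ?_
    filter_upwards [hXM, hDX, hYX] with ω h1 h2 h3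
    refine ⟨⟨?_, ?_⟩, ⟨?_, ?_⟩⟩ <;> dsimp only <;> linarith [h1.1, h1.2, h2.1, h2.2, h3.1, h3.2]
  have hYint : Integrable Y ℙ :=
    integrable_comp_of_ae_mem_compact (K := Icc 0 M) continuous_id hY isCompact_Icc <| by
      filter_upwards [hXM, hYX] with ω h1 h2
      exact ⟨h2.1, h2.2.trans h1.2⟩
  have hDint : Integrable (fun ω => ded d b (X ω) (S ω)) ℙ :=
    integrable_comp_of_ae_mem_compact (K := Icc 0 M) continuous_id hD isCompact_Icc <| by
      filter_upwards [hXM, hDX] with ω h1 h2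
      exact ⟨h2.1, h2.2.trans h1.2⟩
  have hmint : Integrable (fun ω => u' (w - min (X ω) d - b)) ℙ := by
    refine integrable_comp_of_ae_mem_compact (K := Icc (w - d - b) (w - b)) hu'c
      (by fun_prop) isCompact_Icc ?_
    filter_upwards [hXM] with ω h1
    constructor
    · linarith [min_le_right (X ω) d]
    · linarith [le_min h1.1 hd]
  refine ⟨hint, ?_⟩
  have hgain : Integrable
      (fun ω => u' (w - d - b) * (Y ω - ded d b (X ω) (S ω))) ℙ :=
    (hYint.sub hDint).const_mul _
  have hcost := hmint.mul_const (a - b)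
  have hle := integral_mono_ae hint (hgain.sub hcost) (by
      filter_upwards [hS0, hYX, hYS] with ω h1 h2 h3
      exact marginal_le hu' (by linarith) h2.1 h3)
  refine hle.trans ?_
  simp only [Pi.sub_apply]
  rw [integral_sub hgain hcost, integral_const_mul, integral_mul_const, hfoc,
    integral_sub hYint hDint]
  have hfac : u' (w - d - b) * (∫ ω, Y ω ∂ℙ - ∫ ω, ded d b (X ω) (S ω) ∂ℙ) -
      u' (w - d - b) / (1 + η) * (a - b) = u' (w - d - b) / (1 + η) *
        (((1 + η) * ∫ ω, Y ω ∂ℙ - a) - ((1 + η) * ∫ ω, ded d b (X ω) (S ω) ∂ℙ - b)) := by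
    field_simp
    ring
  rw [hfac, hprem]
  have := (div_pos (hu'pos (w - d - b)) (show 0 < 1 + η by linarith)).le
  exact mul_nonpos_of_nonneg_of_nonpos this (by linarith)

lemma integrable_utility {ℙ : Measure Ω} [IsFiniteMeasure ℙ] {X Y : Ω → ℝ} (hX : Measurable X)
    (hY : Measurable Y) {M w a : ℝ} (hXM : ∀ᵐ ω ∂ℙ, X ω ∈ Icc 0 M)
    (hYX : ∀ᵐ ω ∂ℙ, Y ω ∈ Icc 0 (X ω)) {u : ℝ → ℝ} (hu : Continuous u) :
    Integrable (fun ω => u (w - X ω - a + Y ω)) ℙ := by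
  refine integrable_comp_of_ae_mem_compact (K := Icc (w - M - a) (w - a)) hu (by fun_prop)
    isCompact_Icc ?_
  filter_upwards [hXM, hYX] with ω h1 h2
  constructor <;> linarith [h1.1, h1.2, h2.1, h2.2]

/-- Optimality of the deductible contract in the problem where the payoff is chosen subject to
the premium budget and the seller's reserve. -/
lemma integral_utility_le {ℙ : Measure Ω} [IsProbabilityMeasure ℙ] {X S Y : Ω → ℝ}
    (hX : Measurable X) (hS : Measurable S) (hY : Measurable Y) {M η w a b d : ℝ}
    (hXM : ∀ᵐ ω ∂ℙ, X ω ∈ Icc 0 M) (hS0 : ∀ᵐ ω ∂ℙ, 0 ≤ S ω) {u u' : ℝ → ℝ}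
    (hu : ∀ x, HasDerivAt u (u' x) x)
    (hu' : StrictAnti u') (hu'c : Continuous u') (hu'pos : ∀ x, 0 < u' x) (hη : 0 < η)
    (hd : 0 ≤ d) (hb : 0 ≤ b) (hprem : (1 + η) * ∫ ω, ded d b (X ω) (S ω) ∂ℙ = b)
    (hfoc : ∫ ω, u' (w - min (X ω) d - b) ∂ℙ = u' (w - d - b) / (1 + η))
    (hYX : ∀ᵐ ω ∂ℙ, Y ω ∈ Icc 0 (X ω)) (hYS : ∀ᵐ ω ∂ℙ, Y ω ≤ S ω + a)
    (hYprem : (1 + η) * ∫ ω, Y ω ∂ℙ ≤ a) :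
    ∫ ω, u (w - X ω - a + Y ω) ∂ℙ ≤ ∫ ω, u (w - X ω - b + ded d b (X ω) (S ω)) ∂ℙ := by
  obtain ⟨hint, hle⟩ := integral_marginal_nonpos hX hS hY hXM hS0 hu'.antitone hu'c hu'pos hη hd
    hb hprem hfoc hYX hYS hYprem
  have hcont : Continuous u := continuous_iff_continuousAt.2 fun z => (hu z).continuousAt
  have hDX : ∀ᵐ ω ∂ℙ, ded d b (X ω) (S ω) ∈ Icc 0 (X ω) := by
    filter_upwards [hXM, hS0] with ω h1 h2
    exact ⟨ded_nonneg (by linarith), ded_le_loss (by linarith) hd h1.1⟩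
  have hi1 := integrable_utility (w := w) (a := a) hX hY hXM hYX hcont
  have hi2 := integrable_utility (w := w) (a := b) hX (measurable_ded hX hS d b) hXM hDX hcont
  have h := integral_mono hi1 (hi2.add hint) fun ω => le_tangent hu hu' _ _
  simp only [Pi.add_apply] at h
  rw [integral_add hi2 hint] at h
  linarith

lemma measure_Ioc_pos {ℙ : Measure Ω} [IsProbabilityMeasure ℙ] {X : Ω → ℝ} {M : ℝ}
    (h : StrictMonoOn (distFn ℙ X) (Icc 0 M)) {s t : ℝ} (hs : 0 ≤ s) (hst : s < t)
    (ht : t ≤ M) : ℙ {ω | s < X ω ∧ X ω ≤ t} ≠ 0 := by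
  intro h0
  have hlt := h ⟨hs, hst.le.trans ht⟩ ⟨hs.trans hst.le, ht⟩ hst
  refine hlt.not_ge (ENNReal.toReal_mono (measure_ne_top _ _) ?_)
  calc ℙ {ω | X ω ≤ t} ≤ ℙ ({ω | X ω ≤ s} ∪ {ω | s < X ω ∧ X ω ≤ t}) := by
        refine measure_mono fun ω hω => ?_
        rcases le_or_gt (X ω) s with h1 | h1
        · exact Or.inl h1
        · exact Or.inr ⟨h1, hω⟩
    _ ≤ _ := measure_union_le _ _
    _ = ℙ {ω | X ω ≤ s} := by rw [h0, add_zero]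

lemma gA_strictAnti {ℙ : Measure Ω} [IsProbabilityMeasure ℙ] {X S : Ω → ℝ}
    (hX : Measurable X) (hS : Measurable S) {M η a : ℝ} (hXM : ∀ᵐ ω ∂ℙ, X ω ∈ Icc 0 M)
    (hS0 : ∀ᵐ ω ∂ℙ, 0 ≤ S ω) (hF : StrictMonoOn (distFn ℙ X) (Icc 0 M)) (hη : 0 < η)
    (ha : 0 < a) : StrictAntiOn (gA ℙ η X S a) (Icc 0 M) := by
  intro y hy z hz hyz
  have hint : ∀ t, 0 ≤ t → Integrable (fun ω => ded t a (X ω) (S ω)) ℙ := fun t ht =>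
    integrable_comp_of_ae_mem_compact (K := Icc 0 M) continuous_id (measurable_ded hX hS t a)
      isCompact_Icc <| by
        filter_upwards [hXM, hS0] with ω h1 h2
        exact ⟨ded_nonneg (by linarith), (ded_le_loss (by linarith) ht h1.1).trans h1.2⟩
  have hpos : 0 < ∫ ω, (ded y a (X ω) (S ω) - ded z a (X ω) (S ω)) ∂ℙ := by
    have hsub : Integrable (fun ω => ded y a (X ω) (S ω) - ded z a (X ω) (S ω)) ℙ :=
      (hint y hy.1).sub (hint z hz.1)
    rw [integral_pos_iff_support_of_nonneg_ae _ hsub]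
    · have hE := measure_Ioc_pos hF hy.1 (lt_min (lt_add_of_pos_right y ha) (hyz.trans_le hz.2))
        (min_le_right (y + a) M)
      refine (pos_iff_ne_zero.2 hE).trans_le (measure_mono_ae ?_)
      filter_upwards [hS0] with ω h1 h2
      have h3 : y < X ω := h2.1
      have h4 : X ω ≤ y + a := (show X ω ≤ _ from h2.2).trans (min_le_left _ _)
      refine (sub_pos.2 ?_).ne'
      rw [ded_eq_min (by linarith), ded_eq_min (by linarith)]
      refine (min_le_left _ _).trans_lt (lt_min (lt_max_of_lt_left (max_lt ?_ ?_))
        (max_lt ?_ ?_)) <;> linarith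
    · filter_upwards [hS0] with ω h1
      refine sub_nonneg.2 ?_
      rw [ded_eq_min (by linarith), ded_eq_min (by linarith)]
      gcongr
  rw [integral_sub (hint y hy.1) (hint z hz.1)] at hpos
  rw [gA_eq, gA_eq]
  nlinarith

lemma continuousOn_gA {ℙ : Measure Ω} [IsProbabilityMeasure ℙ] {X S : Ω → ℝ}
    (hX : Measurable X) (hS : Measurable S) {M η : ℝ} (hXM : ∀ᵐ ω ∂ℙ, X ω ∈ Icc 0 M)
    (hS0 : ∀ᵐ ω ∂ℙ, 0 ≤ S ω) :
    ContinuousOn (fun p : ℝ × ℝ => gA ℙ η X S p.1 p.2) (Ici 0 ×ˢ Icc 0 M) := by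
  simp only [gA_eq]
  refine (continuousOn_const.mul ?_).sub continuousOn_fst
  refine continuousOn_of_dominated (bound := fun _ => M)
    (fun p _ => (measurable_ded hX hS _ _).aestronglyMeasurable) (fun p hp => ?_)
    (integrable_const _) (.of_forall fun ω => ?_)
  · filter_upwards [hXM, hS0] with ω h1 h2
    have h3 : 0 ≤ S ω + p.1 := add_nonneg h2 hp.1
    rw [Real.norm_of_nonneg (ded_nonneg h3)]
    exact (ded_le_loss h3 hp.2.1 h1.1).trans h1.2
  · unfold ded
    fun_prop

lemma continuousOn_expected_marginal {ℙ : Measure Ω} [IsProbabilityMeasure ℙ] {X : Ω → ℝ}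
    (hX : Measurable X) {M A w : ℝ} {u' : ℝ → ℝ} (hXM : ∀ᵐ ω ∂ℙ, X ω ∈ Icc 0 M)
    (hu' : Antitone u') (hu'c : Continuous u') (hu'pos : ∀ x, 0 < u' x) :
    ContinuousOn (fun p : ℝ × ℝ => ∫ ω, u' (w - min (X ω) p.2 - p.1) ∂ℙ)
      (Icc 0 A ×ˢ Icc 0 M) := by
  refine continuousOn_of_dominated (bound := fun _ => u' (w - M - A)) (fun p _ => ?_)
    (fun p hp => ?_) (integrable_const _) (.of_forall fun ω => ?_)
  · exact (hu'c.measurable.comp (by fun_prop)).aestronglyMeasurable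
  · filter_upwards [hXM] with ω h1
    rw [Real.norm_of_nonneg (hu'pos _).le]
    exact hu' (by linarith [min_le_left (X ω) p.2, h1.2, hp.1.2])
  · fun_prop

lemma gfun_eq_gA {ℙ : Measure Ω} {X S : Ω → ℝ} (hX0 : ∀ ω, 0 ≤ X ω)
    (hS0 : ∀ᵐ ω ∂ℙ, 0 ≤ S ω) {η a : ℝ} (ha : 0 ≤ a) : gfun ℙ η X S a = gA ℙ η X S a 0 := by
  unfold gfun gA
  congr 2
  refine integral_congr_ae ?_
  filter_upwards [hS0] with ω h1
  rw [max_eq_left (add_nonneg h1 ha), sub_zero, max_eq_left (hX0 ω)]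

lemma abar_spec {ℙ : Measure Ω} [IsProbabilityMeasure ℙ] {X S : Ω → ℝ}
    (hX : Measurable X) (hS : Measurable S) (hX0 : ∀ ω, 0 ≤ X ω) {M η : ℝ} (hM0 : 0 < M)
    (hη : 0 < η) (hXM : ∀ᵐ ω ∂ℙ, X ω ∈ Icc 0 M) (hS0 : ∀ᵐ ω ∂ℙ, 0 ≤ S ω)
    (h0 : 0 < gA ℙ η X S 0 0) :
    0 < abar ℙ η X S ∧ gA ℙ η X S (abar ℙ η X S) 0 ≤ 0 ∧
      ∀ a ∈ Ioo 0 (abar ℙ η X S), 0 < gA ℙ η X S a 0 := by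
  have hpi : 0 ≤ piFull ℙ η X := mul_nonneg (by linarith) (integral_nonneg hX0)
  have hXint : Integrable X ℙ :=
    integrable_comp_of_ae_mem_compact continuous_id hX isCompact_Icc hXM
  have hset : {a | a ∈ Icc 0 (piFull ℙ η X) ∧ gfun ℙ η X S a ≤ 0} =
      Icc 0 (piFull ℙ η X) ∩ (fun a => gA ℙ η X S a 0) ⁻¹' Iic 0 := by
    ext a
    refine and_congr_right fun ha => ?_
    rw [gfun_eq_gA hX0 hS0 ha.1]
    rfl
  have hcont : ContinuousOn (fun a => gA ℙ η X S a 0) (Icc 0 (piFull ℙ η X)) :=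
    (continuousOn_gA hX hS hXM hS0).comp (f := fun a : ℝ => (a, (0 : ℝ))) (by fun_prop)
      fun a ha => ⟨ha.1, le_rfl, hM0.le⟩
  have hclosed : IsClosed {a | a ∈ Icc 0 (piFull ℙ η X) ∧ gfun ℙ η X S a ≤ 0} :=
    hset ▸ hcont.preimage_isClosed_of_isClosed isClosed_Icc isClosed_Iic
  have hbdd : BddBelow {a | a ∈ Icc 0 (piFull ℙ η X) ∧ gfun ℙ η X S a ≤ 0} :=
    ⟨0, fun a ha => ha.1.1⟩
  have hne : {a | a ∈ Icc 0 (piFull ℙ η X) ∧ gfun ℙ η X S a ≤ 0}.Nonempty := by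
    refine ⟨piFull ℙ η X, ⟨hpi, le_rfl⟩, ?_⟩
    have hle : ∫ ω, (X ω - max (X ω - max (S ω + piFull ℙ η X) 0) 0) ∂ℙ ≤ ∫ ω, X ω ∂ℙ := by
      refine integral_mono_of_nonneg ?_ hXint (.of_forall fun ω => ?_)
      · exact .of_forall fun ω => sub_nonneg.2
          (max_le (by linarith [le_max_right (S ω + piFull ℙ η X) 0]) (hX0 ω))
      · exact sub_le_self _ (le_max_right _ _)
    exact sub_nonpos.2 (mul_le_mul_of_nonneg_left hle (by linarith))
  have hmem := hclosed.csInf_mem hne hbdd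
  change abar ℙ η X S ∈ _ at hmem
  have hle : gA ℙ η X S (abar ℙ η X S) 0 ≤ 0 := gfun_eq_gA hX0 hS0 hmem.1.1 ▸ hmem.2
  refine ⟨lt_of_le_of_ne hmem.1.1 fun h => ?_, hle, fun a ha => ?_⟩
  · rw [← h] at hle
    exact hle.not_gt h0
  · by_contra hcon
    refine (notMem_of_lt_csInf ha.2 hbdd) ⟨⟨ha.1.le, ha.2.le.trans hmem.1.2⟩, ?_⟩
    rw [gfun_eq_gA hX0 hS0 ha.1.le]
    exact not_lt.1 hcon

/-- Two deductible contracts satisfying the first-order equation have the same premium. -/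
lemma premium_unique {ℙ : Measure Ω} [IsProbabilityMeasure ℙ] {X S : Ω → ℝ}
    (hX : Measurable X) (hS : Measurable S) {M η w a b c d : ℝ}
    (hXM : ∀ᵐ ω ∂ℙ, X ω ∈ Icc 0 M) (hS0 : ∀ᵐ ω ∂ℙ, 0 ≤ S ω) {u' : ℝ → ℝ}
    (hF : StrictMonoOn (distFn ℙ X) (Icc 0 M))
    (hu' : StrictAnti u') (hu'c : Continuous u') (hu'pos : ∀ x, 0 < u' x) (hη : 0 < η)
    (hc : c ∈ Ioc 0 M) (ha : 0 ≤ a) (hprema : (1 + η) * ∫ ω, ded c a (X ω) (S ω) ∂ℙ = a)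
    (hfoca : ∫ ω, u' (w - min (X ω) c - a) ∂ℙ = u' (w - c - a) / (1 + η))
    (hd : d ∈ Ioc 0 M) (hb : 0 ≤ b) (hpremb : (1 + η) * ∫ ω, ded d b (X ω) (S ω) ∂ℙ = b)
    (hfocb : ∫ ω, u' (w - min (X ω) d - b) ∂ℙ = u' (w - d - b) / (1 + η)) :
    a = b := by
  have hDX : ∀ e t : ℝ, 0 ≤ e → 0 ≤ t → ∀ᵐ ω ∂ℙ, ded e t (X ω) (S ω) ∈ Icc 0 (X ω) := by
    intro e t he ht
    filter_upwards [hXM, hS0] with ω h1 h2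
    exact ⟨ded_nonneg (by linarith), ded_le_loss (by linarith) he h1.1⟩
  have hDS : ∀ e t : ℝ, 0 ≤ t → ∀ᵐ ω ∂ℙ, ded e t (X ω) (S ω) ≤ S ω + t := by
    intro e t ht
    filter_upwards [hS0] with ω h2
    exact ded_le_reserve (by linarith)
  obtain ⟨hi1, hl1⟩ := integral_marginal_nonpos hX hS (measurable_ded hX hS c a) hXM hS0
    hu'.antitone hu'c hu'pos hη hd.1.le hb hpremb hfocb (hDX c a hc.1.le ha) (hDS c a ha)
    hprema.le
  obtain ⟨hi2, hl2⟩ := integral_marginal_nonpos hX hS (measurable_ded hX hS d b) hXM hS0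
    hu'.antitone hu'c hu'pos hη hc.1.le ha hprema hfoca (hDX d b hd.1.le hb) (hDS d b hb)
    hpremb.le
  set V : Ω → ℝ := fun ω => w - X ω - a + ded c a (X ω) (S ω) with hV
  set W : Ω → ℝ := fun ω => w - X ω - b + ded d b (X ω) (S ω) with hW
  change Integrable (fun ω => u' (W ω) * (V ω - W ω)) ℙ at hi1
  change Integrable (fun ω => u' (V ω) * (W ω - V ω)) ℙ at hi2
  change ∫ ω, u' (W ω) * (V ω - W ω) ∂ℙ ≤ 0 at hl1
  change ∫ ω, u' (V ω) * (W ω - V ω) ∂ℙ ≤ 0 at hl2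
  have hstrict : ∀ x y : ℝ, x < y → 0 < u' y * (x - y) + u' x * (y - x) := fun x y hxy => by
    nlinarith [hu' hxy]
  have hnonneg : ∀ x y : ℝ, 0 ≤ u' y * (x - y) + u' x * (y - x) := fun x y => by
    rcases lt_trichotomy x y with h | h | h
    · exact (hstrict x y h).le
    · simp [h]
    · linarith [hstrict y x h]
  have hzero : (fun ω => u' (W ω) * (V ω - W ω) + u' (V ω) * (W ω - V ω)) =ᵐ[ℙ] 0 := by
    rw [← integral_eq_zero_iff_of_nonneg (fun ω => hnonneg _ _) (hi1.add hi2)]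
    refine le_antisymm ?_ (integral_nonneg fun ω => hnonneg _ _)
    rw [integral_add hi1 hi2]
    linarith
  have hE := measure_Ioc_pos hF le_rfl (lt_min hc.1 hd.1) ((min_le_left c d).trans hc.2)
  have hfreq : ∃ᵐ ω ∂ℙ, 0 < X ω ∧ X ω ≤ min c d := frequently_ae_iff.2 hE
  obtain ⟨ω, hω, h0, hs⟩ := (hfreq.and_eventually (hzero.and hS0)).exists
  have hVW : V ω = W ω := by
    simp only [Pi.zero_apply] at h0
    rcases lt_trichotomy (V ω) (W ω) with h | h | h
    · exact absurd h0 (hstrict _ _ h).ne'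
    · exact h
    · have := hstrict _ _ h
      linarith
  have hc0 : ded c a (X ω) (S ω) = 0 := by
    rw [ded_eq_min (by linarith), max_eq_right (by linarith [hω.2.trans (min_le_left c d)]),
      min_eq_left (by linarith)]
  have hd0 : ded d b (X ω) (S ω) = 0 := by
    rw [ded_eq_min (by linarith), max_eq_right (by linarith [hω.2.trans (min_le_right c d)]),
      min_eq_left (by linarith)]
  simp only [hV, hW, hc0, hd0] at hVW
  linarith

/-- Global optimality of a deductible contract that satisfies the first-order equation. -/
lemma EU_le_EU_ded {ℙ : Measure Ω} [IsProbabilityMeasure ℙ] {X S : Ω → ℝ}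
    (hX : Measurable X) (hS : Measurable S) {M η τ w b d : ℝ} (hτ : τ ∈ Icc (0 : ℝ) 1)
    (hXM : ∀ᵐ ω ∂ℙ, X ω ∈ Icc 0 M) (hS0 : ∀ᵐ ω ∂ℙ, 0 ≤ S ω) {u u' : ℝ → ℝ}
    (hu : ∀ x, HasDerivAt u (u' x) x)
    (hu' : StrictAnti u') (hu'c : Continuous u') (hu'pos : ∀ x, 0 < u' x) (hη : 0 < η)
    (hd : 0 ≤ d) (hb : 0 ≤ b) (hprem : (1 + η) * ∫ ω, ded d b (X ω) (S ω) ∂ℙ = b)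
    (hfoc : ∫ ω, u' (w - min (X ω) d - b) ∂ℙ = u' (w - d - b) / (1 + η))
    {I : ℝ → ℝ → ℝ} (hI : Adm M I) :
    EU ℙ η τ w X S u I ≤ EU ℙ η τ w X S u (ded d b) := by
  have hIX : ∀ᵐ ω ∂ℙ, I (X ω) (S ω) ∈ Icc 0 (X ω) := hXM.mono fun ω h => hI.2 _ h _
  have hIm : Measurable fun ω => I (X ω) (S ω) := hI.1.comp (hX.prodMk hS)
  have hIint : Integrable (fun ω => I (X ω) (S ω)) ℙ :=
    integrable_comp_of_ae_mem_compact (K := Icc 0 M) continuous_id hIm isCompact_Icc <| by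
      filter_upwards [hXM, hIX] with ω h1 h2
      exact ⟨h2.1, h2.2.trans h1.2⟩
  set a := premium ℙ η X S I with ha_def
  have ha : 0 ≤ a := mul_nonneg (by linarith) (integral_nonneg_of_ae (hIX.mono fun ω h => h.1))
  set Y : Ω → ℝ := fun ω => if I (X ω) (S ω) ≤ max (S ω + a) 0 then I (X ω) (S ω)
    else τ * max (S ω + a) 0 with hY_def
  have hY : Measurable Y :=
    Measurable.ite (measurableSet_le hIm (by fun_prop)) hIm (by fun_prop)
  have hYI : ∀ᵐ ω ∂ℙ, 0 ≤ Y ω ∧ Y ω ≤ I (X ω) (S ω) ∧ Y ω ≤ S ω + a := by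
    filter_upwards [hIX, hS0] with ω h1 h2
    have h3 : 0 ≤ S ω + a := add_nonneg h2 ha
    simp only [hY_def, max_eq_left h3]
    have h4 : τ * (S ω + a) ≤ S ω + a := mul_le_of_le_one_left h3 hτ.2
    split_ifs with h
    · exact ⟨h1.1, le_rfl, h⟩
    · exact ⟨mul_nonneg hτ.1 h3, by linarith, h4⟩
  have hYX : ∀ᵐ ω ∂ℙ, Y ω ∈ Icc 0 (X ω) := by
    filter_upwards [hYI, hIX] with ω h1 h2
    exact ⟨h1.1, h1.2.1.trans h2.2⟩
  have hYprem : (1 + η) * ∫ ω, Y ω ∂ℙ ≤ a :=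
    mul_le_mul_of_nonneg_left (integral_mono_of_nonneg (hYI.mono fun ω h => h.1) hIint
      (hYI.mono fun ω h => h.2.1)) (by linarith)
  have hmain := integral_utility_le (w := w) hX hS hY hXM hS0 hu hu' hu'c hu'pos hη hd hb hprem
    hfoc hYX (hYI.mono fun ω h => h.2.2) hYprem
  refine hmain.trans_eq (integral_congr_ae ?_)
  filter_upwards [hS0] with ω h1
  have h2 : 0 ≤ S ω + b := add_nonneg h1 hb
  have hp : premium ℙ η X S (ded d b) = b := hprem
  simp only [wealth, hp]
  rw [max_eq_left h2, if_pos (ded_le_reserve h2)]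

/-- under Assumption A and `0 < η < u′(w−M)/𝔼[u′(w−X)] − 1`, the first-order
equation `𝔼[u′(w − min(X, d(a)) − a)] = u′(w − d(a) − a)/(1+η)` has a unique solution
`a* ∈ (0, ā)` (where `d(a)` is the unique zero of `g_a` in `[0, M]`), and the contract
`I*(x,s) = (x − d(a*))⁺ − (x − d(a*) − s − a*)⁺` is globally optimal over `𝓐`. -/
theorem stmt10
    (ℙ : Measure Ω) [IsProbabilityMeasure ℙ]
    (X S : Ω → ℝ) (hXm : Measurable X) (hSm : Measurable S)
    (hX0 : ∀ ω, 0 ≤ X ω) (M : ℝ) (hM : essSup X ℙ = M) (hM0 : 0 < M)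
    (η : ℝ) (τ : ℝ) (hτ : τ ∈ Icc (0 : ℝ) 1) (w : ℝ)
    (u u' u'' : ℝ → ℝ)
    (hu' : ∀ x, HasDerivAt u (u' x) x) (hu'' : ∀ x, HasDerivAt u' (u'' x) x)
    (hu'pos : ∀ x, 0 < u' x) (hu''neg : ∀ x, u'' x < 0)
    (hA : AssumpA ℙ X S M)
    (hη0 : 0 < η) (hη1 : η < thr ℙ X u' w M)
    (dfun : ℝ → ℝ)
    (hdfun : ∀ a ∈ Icc 0 (abar ℙ η X S),
      dfun a ∈ Icc (0 : ℝ) M ∧ gA ℙ η X S a (dfun a) = 0) :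
    (∃! astar : ℝ, astar ∈ Ioo 0 (abar ℙ η X S) ∧
      (∫ ω, u' (w - min (X ω) (dfun astar) - astar) ∂ℙ)
        = u' (w - dfun astar - astar) / (1 + η)) ∧
    ∀ astar ∈ Ioo 0 (abar ℙ η X S),
      (∫ ω, u' (w - min (X ω) (dfun astar) - astar) ∂ℙ)
          = u' (w - dfun astar - astar) / (1 + η) →
      ∀ I : ℝ → ℝ → ℝ, Adm M I →
        EU ℙ η τ w X S u I ≤ EU ℙ η τ w X S u (ded (dfun astar) astar) := by
  obtain ⟨hS0, -, -, hF, hA4⟩ := hA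
  have hXM : ∀ᵐ ω ∂ℙ, X ω ∈ Icc 0 M :=
    (ae_le_of_essSup_eq hM hM0).mono fun ω h => ⟨hX0 ω, h⟩
  have hanti : StrictAnti u' := strictAnti_of_hasDerivAt_neg hu'' hu''neg
  have hu'c : Continuous u' := continuous_iff_continuousAt.2 fun z => (hu'' z).continuousAt
  have hη : 0 < 1 + η := by linarith
  have hgA0 : ∀ y ∈ Ico 0 M, 0 < gA ℙ η X S 0 y := fun y hy => by
    simpa [gA] using mul_pos hη (hA4 y hy)
  obtain ⟨habar, habar_le, hbelow⟩ :=
    abar_spec hXm hSm hX0 hM0 hη0 hXM hS0 (hgA0 0 ⟨le_rfl, hM0⟩)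
  have hdec : ∀ a, 0 < a → StrictAntiOn (gA ℙ η X S a) (Icc 0 M) := fun a ha =>
    gA_strictAnti hXm hSm hXM hS0 hF hη0 ha
  have hprem : ∀ a ∈ Icc 0 (abar ℙ η X S),
      (1 + η) * ∫ ω, ded (dfun a) a (X ω) (S ω) ∂ℙ = a := fun a ha => by
    have h := (hdfun a ha).2
    rw [gA_eq] at h
    linarith
  have hdpos : ∀ a ∈ Ioo 0 (abar ℙ η X S), dfun a ∈ Ioc 0 M := fun a ha => by
    obtain ⟨h1, h2⟩ := hdfun a ⟨ha.1.le, ha.2.le⟩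
    refine ⟨lt_of_le_of_ne h1.1 fun h => ?_, h1.2⟩
    rw [← h] at h2
    exact (hbelow a ha).ne' h2
  have hd0 : dfun 0 = M := by
    obtain ⟨h1, h2⟩ := hdfun 0 ⟨le_rfl, habar.le⟩
    by_contra hne
    exact (hgA0 _ ⟨h1.1, lt_of_le_of_ne h1.2 hne⟩).ne' h2
  have hdabar : dfun (abar ℙ η X S) = 0 := by
    obtain ⟨h1, h2⟩ := hdfun _ ⟨habar.le, le_rfl⟩
    by_contra hne
    have := hdec _ habar ⟨le_rfl, hM0.le⟩ h1 (lt_of_le_of_ne h1.1 (Ne.symm hne))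
    linarith
  have hdcont : ContinuousOn dfun (Icc 0 (abar ℙ η X S)) := by
    refine continuousOn_of_unique_zero (f := fun p => gA ℙ η X S p.1 p.2) (K := Icc 0 M)
      isCompact_Icc
      ((continuousOn_gA hXm hSm hXM hS0).mono (prod_mono_left fun a ha => ha.1))
      (fun a ha => (hdfun a ha).1) (fun a ha => (hdfun a ha).2) fun a ha y hy h => ?_
    rcases ha.1.eq_or_lt with h0 | h0
    · subst h0
      rw [hd0]
      by_contra hne
      exact (hgA0 _ ⟨hy.1, lt_of_le_of_ne hy.2 hne⟩).ne' h
    · exact (hdec a h0).injOn hy (hdfun a ha).1 (h.trans (hdfun a ha).2.symm)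
  have hFcont : ContinuousOn (fun a => (∫ ω, u' (w - min (X ω) (dfun a) - a) ∂ℙ) -
      u' (w - dfun a - a) / (1 + η)) (Icc 0 (abar ℙ η X S)) := by
    refine ContinuousOn.sub ?_ ?_
    · exact (continuousOn_expected_marginal (A := abar ℙ η X S) (w := w) hXm hXM hanti.antitone
        hu'c hu'pos).comp (f := fun a => (a, dfun a)) (continuousOn_id.prodMk hdcont)
        fun a ha => ⟨ha, (hdfun a ha).1⟩
    · exact (hu'c.comp_continuousOn
        ((continuousOn_const.sub hdcont).sub continuousOn_id)).div_const _
  have hleft : (∫ ω, u' (w - min (X ω) (dfun 0) - 0) ∂ℙ) - u' (w - dfun 0 - 0) / (1 + η) < 0 := by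
    have hcongr : ∫ ω, u' (w - min (X ω) M - 0) ∂ℙ = ∫ ω, u' (w - X ω) ∂ℙ := by
      refine integral_congr_ae ?_
      filter_upwards [hXM] with ω h
      rw [min_eq_left h.2, sub_zero]
    have hpos : 0 < ∫ ω, u' (w - X ω) ∂ℙ := by
      by_contra hcon
      have h0 : ∫ ω, u' (w - X ω) ∂ℙ = 0 :=
        le_antisymm (not_lt.1 hcon) (integral_nonneg fun ω => (hu'pos _).le)
      rw [thr, h0, div_zero] at hη1
      linarith
    rw [hd0, hcongr, sub_zero, sub_neg, lt_div_iff₀ hη, mul_comm, ← lt_div_iff₀ hpos]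
    unfold thr at hη1
    linarith
  have hright : 0 < (∫ ω, u' (w - min (X ω) (dfun (abar ℙ η X S)) - abar ℙ η X S) ∂ℙ) -
      u' (w - dfun (abar ℙ η X S) - abar ℙ η X S) / (1 + η) := by
    simp only [hdabar, min_eq_right (hX0 _), integral_const, probReal_univ, one_smul]
    exact sub_pos.2 (div_lt_self (hu'pos _) (by linarith))
  refine ⟨?_, fun b hb hfoc I hI => ?_⟩
  · obtain ⟨b, hb, hb0⟩ := intermediate_value_Ioo habar.le hFcont ⟨hleft, hright⟩
    refine ⟨b, ⟨hb, sub_eq_zero.1 hb0⟩, fun a ⟨ha, hfoc⟩ => ?_⟩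
    exact premium_unique hXm hSm hXM hS0 hF hanti hu'c hu'pos hη0
      (hdpos a ha) ha.1.le (hprem a ⟨ha.1.le, ha.2.le⟩) hfoc
      (hdpos b hb) hb.1.le (hprem b ⟨hb.1.le, hb.2.le⟩) (sub_eq_zero.1 hb0)
  · exact EU_le_EU_ded hXm hSm hτ hXM hS0 hu' hanti hu'c hu'pos hη0 (hdpos b hb).1.le hb.1.le
      (hprem b ⟨hb.1.le, hb.2.le⟩) hfoc hI
end
end
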